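/- arXiv:2604.12853 — 2 statements merged into one kernel-verified Lean document; each statement's English description precedes it below -/
import Mathlib

section
/- In the standing setup, let W = MC(α,P) be the time-homogeneous Markov chain on Δ' with the explicitly defined initial distribution α and transition matrix P. Then the coordinate projections of W have the prescribed laws: proj¹(W) =ᵈ X̄ and proj²(W) =ᵈ Ȳ. Moreover, for every k ≥ 0 and (a_0,b_0), …, (a_k,b_k) ∈ Δ', P(W_0 = (a_0,b_0), …, W_k = (a_k,b_k)) = E[ L_∞(a_0,…,a_k) · M_∞(b_0,…,b_k) ]. -/
open MeasureTheory Filter Topology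
open scoped ENNReal Classical

/-- A probability vector on a countable state space. -/
def IsProbVec {U : Type*} (v : U → ℝ≥0∞) : Prop := ∑' u, v u = 1

/-- A row-stochastic matrix on a countable state space. -/
def IsStochastic {U : Type*} (P : U → U → ℝ≥0∞) : Prop := ∀ u, ∑' w, P u w = 1

/-- `μ` is the law of the time-homogeneous Markov chain `MC(v,P)`. -/
def IsMarkovChain {U : Type*} [MeasurableSpace U]
    (v : U → ℝ≥0∞) (P : U → U → ℝ≥0∞) (μ : Measure (ℕ → U)) : Prop :=
  IsProbabilityMeasure μ ∧ IsProbVec v ∧ IsStochastic P ∧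
    ∀ (k : ℕ) (a : ℕ → U),
      μ {ω | ∀ i ≤ k, ω i = a i} = v (a 0) * ∏ i ∈ Finset.range k, P (a i) (a (i + 1))

/-- The conditional probability of the cylinder event `{X_0 = a_0, …, X_k = a_k}` given
`f(X_0) = z_0, …, f(X_m) = z_m`, as a function of the image trajectory `z`.  (For `μ_Z`-a.e.
`z` the conditioning event has positive probability and this ratio is the usual elementary
conditional probability; these are the martingales `L_m`, resp. `M_m`.) -/
noncomputable def condCyl {A C : Type*} [MeasurableSpace A]
    (μ : Measure (ℕ → A)) (f : A → C) (z : ℕ → C) (m k : ℕ) (a : Fin (k + 1) → A) : ℝ≥0∞ :=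
  μ {ω | (∀ i : Fin (k + 1), ω i.1 = a i) ∧ ∀ j ≤ m, f (ω j) = z j}
    / μ {ω | ∀ j ≤ m, f (ω j) = z j}

/-- `Δ(f,g) = {(a,b) : f a = g b}`. -/
abbrev Delta {A B C : Type*} (f : A → C) (g : B → C) :=
  {p : A × B // f p.1 = g p.2}

/-- The matrix `R` on `Δ(f,g)`. -/
noncomputable def Rmat {A B C : Type*} (PX : A → A → ℝ≥0∞) (PY : B → B → ℝ≥0∞)
    (PZ : C → C → ℝ≥0∞) (f : A → C) (g : B → C) (d e : Delta f g) : ℝ≥0∞ :=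
  if PZ (f d.1.1) (f e.1.1) ≠ 0 then
    PX d.1.1 e.1.1 * PY d.1.2 e.1.2 / PZ (f d.1.1) (f e.1.1)
  else 0

/-- `phim R m = R^m 1`, computed coordinatewise in `[0,∞]`. -/
noncomputable def phim {D : Type*} (R : D → D → ℝ≥0∞) : ℕ → D → ℝ≥0∞
  | 0 => fun _ => 1
  | m + 1 => fun d => ∑' e, R d e * phim R m e

/-- The initial distribution `α` of the coupled chain on `Δ'`. -/
noncomputable def alphaW {A B C : Type*} (αX : A → ℝ≥0∞) (αY : B → ℝ≥0∞) (αZ : C → ℝ≥0∞)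
    (f : A → C) (g : B → C) (φ : Delta f g → ℝ≥0∞) (d : Delta f g) : ℝ≥0∞ :=
  if αZ (f d.1.1) ≠ 0 then αX d.1.1 * αY d.1.2 / αZ (f d.1.1) * φ d else 0

section Cylinders

variable {A C : Type*} [MeasurableSpace A]

theorem tsum_measure_fiber_inter {Ω U : Type*} [MeasurableSpace Ω] [Countable U] [MeasurableSpace U]
    [MeasurableSingletonClass U]
    (μ : Measure Ω) {T : Ω → U} (hT : Measurable T) {S : Set Ω}
    (hS : MeasurableSet S) : ∑' u, μ (T ⁻¹' {u} ∩ S) = μ S := by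
  have h := tsum_measure_preimage_singleton (μ := μ.restrict S) Set.countable_univ
    (f := T) (fun y _ => hT (measurableSet_singleton y))
  rw [tsum_univ (fun u => μ.restrict S (T ⁻¹' {u}))] at h
  simpa [Measure.restrict_apply' hS] using h

theorem measurableSet_forall_le_eq [Countable A] [MeasurableSingletonClass A]
    (f : A → C) (m : ℕ) (z : ℕ → C) :
    MeasurableSet {ω : ℕ → A | ∀ j ≤ m, f (ω j) = z j} := by
  simp only [Set.ofPred_forall]
  refine MeasurableSet.iInter fun j => MeasurableSet.iInter fun _ => ?_
  have hj : Measurable fun ω : ℕ → A => ω j := measurable_pi_apply j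
  exact hj (Set.to_countable {a | f a = z j}).measurableSet

theorem measurableSet_forall_fin_eq [MeasurableSingletonClass A]
    (k : ℕ) (a : Fin (k + 1) → A) :
    MeasurableSet {ω : ℕ → A | ∀ i : Fin (k + 1), ω i.1 = a i} := by
  simp only [Set.ofPred_forall]
  refine MeasurableSet.iInter fun i => ?_
  have hi : Measurable fun ω : ℕ → A => ω i.1 := measurable_pi_apply i.1
  exact hi (measurableSet_singleton (a i))

theorem measurable_of_eq_on_le [Countable C] [MeasurableSpace C] [MeasurableSingletonClass C]
    {m : ℕ} {F : (ℕ → C) → ℝ≥0∞}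
    (hF : ∀ z z' : ℕ → C, (∀ j ≤ m, z j = z' j) → F z = F z') : Measurable F := by
  have h : F = (fun w : Fin (m + 1) → C => F fun i => w ⟨min i m, by omega⟩) ∘
      fun z i => z i.1 := by
    funext z
    exact hF _ _ fun j hj => by simp [hj]
  rw [h]
  exact (measurable_of_countable _).comp (by fun_prop)

theorem measurable_condCyl [Countable C] [MeasurableSpace C] [MeasurableSingletonClass C]
    (μ : Measure (ℕ → A)) (f : A → C) (m k : ℕ) (a : Fin (k + 1) → A) :
    Measurable fun z => condCyl μ f z m k a := by
  refine measurable_of_eq_on_le (m := m) fun z z' h => ?_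
  have h1 : ∀ ω : ℕ → A, (∀ j ≤ m, f (ω j) = z j) ↔ ∀ j ≤ m, f (ω j) = z' j := fun ω =>
    forall₂_congr fun j hj => by rw [h j hj]
  simp only [condCyl, h1]

theorem condCyl_le_one (μ : Measure (ℕ → A)) (f : A → C) (z : ℕ → C) (m k : ℕ)
    (a : Fin (k + 1) → A) : condCyl μ f z m k a ≤ 1 :=
  ENNReal.div_le_of_le_mul (by rw [one_mul]; exact measure_mono fun ω h => h.2)

theorem tsum_condCyl_le_one [Countable A] [MeasurableSingletonClass A]
    (μ : Measure (ℕ → A)) (f : A → C) (z : ℕ → C) (m k : ℕ) :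
    ∑' a, condCyl μ f z m k a ≤ 1 := by
  have hT : Measurable fun (ω : ℕ → A) (i : Fin (k + 1)) => ω i.1 := by fun_prop
  have h := tsum_measure_fiber_inter μ hT (measurableSet_forall_le_eq f m z)
  have h2 : ∀ a : Fin (k + 1) → A, condCyl μ f z m k a =
      μ ((fun (ω : ℕ → A) (i : Fin (k + 1)) => ω i.1) ⁻¹' {a} ∩
        {ω | ∀ j ≤ m, f (ω j) = z j}) * (μ {ω | ∀ j ≤ m, f (ω j) = z j})⁻¹ := fun a => by
    rw [condCyl, div_eq_mul_inv]
    congr 2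
    ext ω
    simp [funext_iff]
  simp_rw [h2]
  rw [ENNReal.tsum_mul_right, h, ← div_eq_mul_inv]
  exact ENNReal.div_self_le_one

theorem condCyl_eq_zero (μ : Measure (ℕ → A)) {f : A → C} {z : ℕ → C} {m k : ℕ}
    {a : Fin (k + 1) → A} (i : Fin (k + 1)) (hi : i.1 ≤ m) (h : f (a i) ≠ z i.1) :
    condCyl μ f z m k a = 0 := by
  have : {ω : ℕ → A | (∀ i : Fin (k + 1), ω i.1 = a i) ∧ ∀ j ≤ m, f (ω j) = z j} = ∅ := by
    ext ω
    simp only [Set.mem_ofPred_eq, Set.mem_empty_iff_false, iff_false, not_and]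
    intro h1 h2
    exact h (by rw [← h1 i, h2 _ hi])
  simp [condCyl, this]

theorem forall_fin_update_iff {A : Type*} (k : ℕ) (a ω : ℕ → A) (a' : A) :
    (∀ i : Fin (k + 1 + 1), ω i.1 = Function.update a (k + 1) a' i.1) ↔
      ω (k + 1) = a' ∧ ∀ i : Fin (k + 1), ω i.1 = a i.1 := by
  rw [Fin.forall_fin_succ']
  simp only [Fin.val_castSucc, Fin.val_last, Function.update_self]
  rw [and_comm]
  refine and_congr_right fun _ => forall_congr' fun i => ?_
  rw [Function.update_of_ne (by omega)]

theorem condCyl_eq_tsum [Countable A] [MeasurableSingletonClass A]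
    (μ : Measure (ℕ → A)) (f : A → C) (z : ℕ → C) (m k : ℕ) (a : ℕ → A) :
    condCyl μ f z m k (fun i => a i.1) =
      ∑' a', condCyl μ f z m (k + 1) (fun i => Function.update a (k + 1) a' i.1) := by
  have hS : MeasurableSet {ω : ℕ → A | (∀ i : Fin (k + 1), ω i.1 = a i.1) ∧
      ∀ j ≤ m, f (ω j) = z j} :=
    (measurableSet_forall_fin_eq k fun i => a i.1).inter (measurableSet_forall_le_eq f m z)
  simp only [condCyl, div_eq_mul_inv]
  rw [ENNReal.tsum_mul_right, ← tsum_measure_fiber_inter μ (measurable_pi_apply (k + 1)) hS]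
  congr 2
  funext a'
  congr 1
  ext ω
  simp only [forall_fin_update_iff, Set.mem_inter_iff, Set.mem_preimage, Set.mem_singleton_iff,
    Set.mem_ofPred_eq, and_assoc]

theorem measure_forall_eq_of_map [Countable A] [MeasurableSingletonClass A]
    [Countable C] [MeasurableSpace C] [MeasurableSingletonClass C]
    {μ : Measure (ℕ → A)} {ν : Measure (ℕ → C)} {f : A → C}
    (h : μ.map (fun ω n => f (ω n)) = ν) (m : ℕ) (z : ℕ → C) :
    μ {ω | ∀ j ≤ m, f (ω j) = z j} = ν {ζ | ∀ j ≤ m, ζ j = z j} := by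
  have hf : Measurable f := measurable_of_countable f
  rw [← h, Measure.map_apply (by fun_prop) (by exact measurableSet_forall_le_eq id m z)]
  rfl

theorem condCyl_full [Countable A] [MeasurableSingletonClass A]
    [Countable C] [MeasurableSpace C] [MeasurableSingletonClass C]
    {μ : Measure (ℕ → A)} {ν : Measure (ℕ → C)} {f : A → C}
    (h : μ.map (fun ω n => f (ω n)) = ν) (m : ℕ) (a : ℕ → A) :
    (fun z => condCyl μ f z m m (fun i => a i.1)) =
      {z | ∀ j ≤ m, z j = f (a j)}.indicator
        fun _ => μ {ω | ∀ i ≤ m, ω i = a i} / ν {ζ | ∀ j ≤ m, ζ j = f (a j)} := by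
  funext z
  by_cases hz : ∀ j ≤ m, z j = f (a j)
  · rw [Set.indicator_of_mem (by exact hz), condCyl]
    have h1 : ∀ ω : ℕ → A, (∀ j ≤ m, f (ω j) = z j) ↔ ∀ j ≤ m, f (ω j) = f (a j) := fun ω =>
      forall₂_congr fun j hj => by rw [hz j hj]
    simp only [h1]
    rw [measure_forall_eq_of_map h m fun j => f (a j)]
    congr 2
    ext ω
    simp only [Set.mem_ofPred_eq, Fin.forall_iff, Nat.lt_succ_iff]
    exact ⟨fun H => H.1, fun H => ⟨H, fun j hj => by rw [H j hj]⟩⟩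
  · rw [Set.indicator_of_notMem (by exact hz)]
    push Not at hz
    obtain ⟨j, hj, hne⟩ := hz
    exact condCyl_eq_zero μ ⟨j, by omega⟩ hj hne.symm

theorem lintegral_condCyl_le [Countable A] [MeasurableSingletonClass A]
    [Countable C] [MeasurableSpace C] [MeasurableSingletonClass C]
    {μ : Measure (ℕ → A)} {ν : Measure (ℕ → C)} {f : A → C}
    (h : μ.map (fun ω n => f (ω n)) = ν) [IsFiniteMeasure ν] (n k : ℕ) (a : ℕ → A) :
    ∫⁻ z, condCyl μ f z (k + n) k (fun i => a i.1) ∂ν ≤ μ {ω | ∀ i ≤ k, ω i = a i} := by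
  induction n generalizing k a with
  | zero =>
    have hS : MeasurableSet {z : ℕ → C | ∀ j ≤ k, z j = f (a j)} :=
      measurableSet_forall_le_eq id k fun j => f (a j)
    rw [add_zero, condCyl_full h, lintegral_indicator_const hS]
    rw [div_eq_mul_inv, mul_assoc]
    exact mul_le_of_le_one_right' (ENNReal.inv_mul_le_one _)
  | succ n ih =>
    simp_rw [condCyl_eq_tsum μ f _ _ k a]
    rw [lintegral_tsum fun _ => (measurable_condCyl μ f _ _ _).aemeasurable]
    have hS : MeasurableSet {ω : ℕ → A | ∀ i ≤ k, ω i = a i} :=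
      measurableSet_forall_le_eq id k a
    rw [← tsum_measure_fiber_inter μ (measurable_pi_apply (k + 1)) hS]
    refine ENNReal.tsum_le_tsum fun a' => ?_
    rw [show k + (n + 1) = k + 1 + n by omega]
    refine (ih (k + 1) (Function.update a (k + 1) a')).trans_eq ?_
    congr 1
    ext ω
    have := forall_fin_update_iff k a ω a'
    simp only [Fin.forall_iff, Nat.lt_succ_iff] at this
    simp [this]

end Cylinders

section Coupling

variable {A B C : Type*}

/-- The weight `αX(a₀) αY(b₀) / αZ(c₀) · R(d₀,d₁) ⋯ R(d_{k-1},d_k)` of a path in `Δ(f,g)`. -/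
noncomputable def pathWeight (αX : A → ℝ≥0∞) (PX : A → A → ℝ≥0∞) (αY : B → ℝ≥0∞)
    (PY : B → B → ℝ≥0∞) (αZ : C → ℝ≥0∞) (PZ : C → C → ℝ≥0∞) (f : A → C) (g : B → C)
    (k : ℕ) (d : ℕ → Delta f g) : ℝ≥0∞ :=
  alphaW αX αY αZ f g 1 (d 0) * ∏ i ∈ Finset.range k, Rmat PX PY PZ f g (d i) (d (i + 1))

theorem IsProbVec.ne_top {U : Type*} {v : U → ℝ≥0∞} (h : IsProbVec v) (u : U) : v u ≠ ∞ :=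
  ((ENNReal.le_tsum u).trans_lt (h.trans_lt ENNReal.one_lt_top)).ne

variable {αX : A → ℝ≥0∞} {PX : A → A → ℝ≥0∞} {αY : B → ℝ≥0∞} {PY : B → B → ℝ≥0∞}
  {αZ : C → ℝ≥0∞} {PZ : C → C → ℝ≥0∞} {f : A → C} {g : B → C}

theorem pathWeight_mul (hα : ∀ c, αZ c ≠ ∞) (hP : ∀ c c', PZ c c' ≠ ∞) (k : ℕ)
    (d : ℕ → Delta f g)
    (h0 : αZ (f (d 0).1.1) * ∏ i ∈ Finset.range k, PZ (f (d i).1.1) (f (d (i + 1)).1.1) ≠ 0) :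
    pathWeight αX PX αY PY αZ PZ f g k d *
        (αZ (f (d 0).1.1) * ∏ i ∈ Finset.range k, PZ (f (d i).1.1) (f (d (i + 1)).1.1)) =
      (αX (d 0).1.1 * ∏ i ∈ Finset.range k, PX (d i).1.1 (d (i + 1)).1.1) *
        (αY (d 0).1.2 * ∏ i ∈ Finset.range k, PY (d i).1.2 (d (i + 1)).1.2) := by
  rw [mul_ne_zero_iff, Finset.prod_ne_zero_iff] at h0
  have h1 : alphaW αX αY αZ f g 1 (d 0) * αZ (f (d 0).1.1) = αX (d 0).1.1 * αY (d 0).1.2 := by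
    rw [alphaW, if_pos h0.1, Pi.one_apply, mul_one, ENNReal.div_mul_cancel h0.1 (hα _)]
  have h2 : ∀ i ∈ Finset.range k, Rmat PX PY PZ f g (d i) (d (i + 1)) *
      PZ (f (d i).1.1) (f (d (i + 1)).1.1) =
      PX (d i).1.1 (d (i + 1)).1.1 * PY (d i).1.2 (d (i + 1)).1.2 := fun i hi => by
    rw [Rmat, if_pos (h0.2 i hi), ENNReal.div_mul_cancel (h0.2 i hi) (hP _ _)]
  rw [pathWeight, mul_mul_mul_comm, h1, ← Finset.prod_mul_distrib, Finset.prod_congr rfl h2,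
    Finset.prod_mul_distrib, mul_mul_mul_comm]

theorem pathWeight_eq_zero (k : ℕ) (d : ℕ → Delta f g)
    (h0 : αZ (f (d 0).1.1) * ∏ i ∈ Finset.range k, PZ (f (d i).1.1) (f (d (i + 1)).1.1) = 0) :
    pathWeight αX PX αY PY αZ PZ f g k d = 0 := by
  rw [pathWeight, mul_eq_zero, Finset.prod_eq_zero_iff]
  rcases mul_eq_zero.1 h0 with h | h
  · exact Or.inl (by simp [alphaW, h])
  · obtain ⟨i, hi, h⟩ := Finset.prod_eq_zero_iff.1 h
    exact Or.inr ⟨i, hi, by simp [Rmat, h]⟩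

theorem pathWeight_update (k : ℕ) (d : ℕ → Delta f g) (e : Delta f g) :
    pathWeight αX PX αY PY αZ PZ f g (k + 1) (Function.update d (k + 1) e) =
      pathWeight αX PX αY PY αZ PZ f g k d * Rmat PX PY PZ f g (d k) e := by
  rw [pathWeight, pathWeight, Finset.prod_range_succ, Function.update_self,
    Function.update_of_ne (by omega), Function.update_of_ne (by omega), mul_assoc]
  congr 2
  refine Finset.prod_congr rfl fun i hi => ?_
  have := Finset.mem_range.1 hi
  rw [Function.update_of_ne (by omega), Function.update_of_ne (by omega)]

theorem coupling_cylinder [MeasurableSpace A] [MeasurableSpace B] {φ : Delta f g → ℝ≥0∞}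
    {μW : Measure (ℕ → {d : Delta f g // φ d ≠ 0})}
    (hW : IsMarkovChain (fun d => alphaW αX αY αZ f g φ d.1)
      (fun d e => Rmat PX PY PZ f g d.1 e.1 * φ e.1 / φ d.1) μW)
    (k : ℕ) (d : ℕ → {d : Delta f g // φ d ≠ 0}) :
    μW {ω | ∀ i ≤ k, ω i = d i} =
      pathWeight αX PX αY PY αZ PZ f g k (fun i => (d i).1) * φ (d k).1 := by
  obtain ⟨_, -, hP, hcyl⟩ := hW
  have htop : ∀ e : {d : Delta f g // φ d ≠ 0}, φ e.1 ≠ ∞ := fun e he => by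
    have := hP e
    simp [he] at this
  rw [hcyl]
  induction k with
  | zero =>
    simp only [pathWeight, alphaW, Finset.range_zero, Finset.prod_empty, mul_one, Pi.one_apply]
    split_ifs <;> simp
  | succ k ih =>
    rw [Finset.prod_range_succ, ← mul_assoc, ih, pathWeight, pathWeight, Finset.prod_range_succ,
      mul_assoc, ENNReal.mul_div_cancel (d k).2 (htop _)]
    ring

variable [Countable A] [MeasurableSpace A] [MeasurableSingletonClass A]
  [Countable B] [MeasurableSpace B] [MeasurableSingletonClass B]

theorem condCyl_mul_condCyl_eq_tsum (μ : Measure (ℕ → A)) (ν : Measure (ℕ → B)) (z : ℕ → C)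
    {m k : ℕ} (hk : k + 1 ≤ m) (d : ℕ → Delta f g) :
    condCyl μ f z m k (fun i => (d i.1).1.1) * condCyl ν g z m k (fun i => (d i.1).1.2) =
      ∑' e : Delta f g,
        condCyl μ f z m (k + 1) (fun i => (Function.update d (k + 1) e i.1).1.1) *
          condCyl ν g z m (k + 1) (fun i => (Function.update d (k + 1) e i.1).1.2) := by
  rw [condCyl_eq_tsum μ f z m k fun i => (d i).1.1, condCyl_eq_tsum ν g z m k fun i => (d i).1.2,
    ← ENNReal.tsum_mul_right]
  simp_rw [← ENNReal.tsum_mul_left]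
  rw [← ENNReal.tsum_prod (f := fun a b =>
      condCyl μ f z m (k + 1) (fun i => Function.update (fun i => (d i).1.1) (k + 1) a i.1) *
        condCyl ν g z m (k + 1) (fun i => Function.update (fun i => (d i).1.2) (k + 1) b i.1)),
    ← tsum_subtype_eq_of_support_subset (s := {p : A × B | f p.1 = g p.2})]
  · refine tsum_congr fun e => ?_
    congr 2 <;>
    · funext i
      by_cases hi : i.1 = k + 1
      · simp [hi]
      · simp [Function.update_of_ne hi]
  · intro p hp
    by_contra hne
    apply hp
    beta_reduce
    by_cases hf : f p.1 = z (k + 1)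
    · rw [condCyl_eq_zero ν (Fin.last (k + 1)) hk, mul_zero]
      simp only [Fin.val_last, Function.update_self]
      exact fun h => hne (hf.trans h.symm)
    · rw [condCyl_eq_zero μ (Fin.last (k + 1)) hk, zero_mul]
      simpa only [Fin.val_last, Function.update_self] using hf

variable [Countable C] [MeasurableSpace C] [MeasurableSingletonClass C]
  {μX : Measure (ℕ → A)} {μY : Measure (ℕ → B)} {μZ : Measure (ℕ → C)}

theorem lintegral_condCyl_mul_full (hX : IsMarkovChain αX PX μX) (hY : IsMarkovChain αY PY μY)
    (hZ : IsMarkovChain αZ PZ μZ) (hf : μX.map (fun ω n => f (ω n)) = μZ)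
    (hg : μY.map (fun ω n => g (ω n)) = μZ) (k : ℕ) (d : ℕ → Delta f g) :
    ∫⁻ z, condCyl μX f z k k (fun i => (d i.1).1.1) *
        condCyl μY g z k k (fun i => (d i.1).1.2) ∂μZ =
      pathWeight αX PX αY PY αZ PZ f g k d := by
  obtain ⟨_, hα, hP, hcyl⟩ := hZ
  set S : Set (ℕ → C) := {z | ∀ j ≤ k, z j = f (d j).1.1} with hS
  have hSm : MeasurableSet S := measurableSet_forall_le_eq id k fun j => f (d j).1.1
  have hgf : ∀ j, g (d j).1.2 = f (d j).1.1 := fun j => (d j).2.symm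
  have h1 := condCyl_full hf k fun i => (d i).1.1
  have h2 := condCyl_full hg k fun i => (d i).1.2
  simp only [hgf] at h2
  rw [← hS] at h1 h2
  have h3 : (fun z => condCyl μX f z k k (fun i => (d i.1).1.1) *
      condCyl μY g z k k (fun i => (d i.1).1.2)) = S.indicator fun _ =>
        μX {ω | ∀ i ≤ k, ω i = (d i).1.1} / μZ S * (μY {ω | ∀ i ≤ k, ω i = (d i).1.2} / μZ S) := by
    funext z
    rw [congrFun h1 z, congrFun h2 z]
    by_cases hz : z ∈ S <;> simp [hz]
  have hμS : μZ S = αZ (f (d 0).1.1) *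
      ∏ i ∈ Finset.range k, PZ (f (d i).1.1) (f (d (i + 1)).1.1) :=
    hcyl k fun j => f (d j).1.1
  rw [h3, lintegral_indicator_const hSm]
  by_cases h0 : μZ S = 0
  · rw [h0, mul_zero, pathWeight_eq_zero k d (hμS ▸ h0)]
  · have htop : μZ S ≠ ∞ := measure_ne_top μZ S
    have hw := pathWeight_mul (αX := αX) (PX := PX) (αY := αY) (PY := PY) hα.ne_top
      (fun c => IsProbVec.ne_top (hP c)) k d (hμS ▸ h0)
    have hXc := hX.2.2.2 k fun i => (d i).1.1
    have hYc := hY.2.2.2 k fun i => (d i).1.2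
    rw [← hμS, ← hXc, ← hYc] at hw
    rw [mul_assoc, ENNReal.div_mul_cancel h0 htop, ENNReal.mul_comm_div, ← mul_div_assoc,
      ← hw, ENNReal.mul_div_cancel_right h0 htop]

theorem lintegral_condCyl_mul (hX : IsMarkovChain αX PX μX) (hY : IsMarkovChain αY PY μY)
    (hZ : IsMarkovChain αZ PZ μZ) (hf : μX.map (fun ω n => f (ω n)) = μZ)
    (hg : μY.map (fun ω n => g (ω n)) = μZ) (n k : ℕ) (d : ℕ → Delta f g) :
    ∫⁻ z, condCyl μX f z (k + n) k (fun i => (d i.1).1.1) *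
        condCyl μY g z (k + n) k (fun i => (d i.1).1.2) ∂μZ =
      pathWeight αX PX αY PY αZ PZ f g k d * phim (Rmat PX PY PZ f g) n (d k) := by
  induction n generalizing k d with
  | zero =>
    rw [add_zero, lintegral_condCyl_mul_full hX hY hZ hf hg, phim, mul_one]
  | succ n ih =>
    simp_rw [condCyl_mul_condCyl_eq_tsum μX μY _ (show k + 1 ≤ k + (n + 1) by omega) d]
    rw [lintegral_tsum fun _ => ((measurable_condCyl μX f _ _ _).fun_mul
      (measurable_condCyl μY g _ _ _)).aemeasurable, phim, ← ENNReal.tsum_mul_left]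
    refine tsum_congr fun e => ?_
    rw [show k + (n + 1) = k + 1 + n by omega, ih, pathWeight_update, Function.update_self,
      mul_assoc]

theorem tendsto_lintegral_condCyl_mul (hX : IsMarkovChain αX PX μX)
    (hY : IsMarkovChain αY PY μY) (hZ : IsMarkovChain αZ PZ μZ)
    (hf : μX.map (fun ω n => f (ω n)) = μZ) (hg : μY.map (fun ω n => g (ω n)) = μZ)
    {φ : Delta f g → ℝ≥0∞}
    (hφ : ∀ d, Tendsto (fun m => phim (Rmat PX PY PZ f g) m d) atTop (𝓝 (φ d)))
    (k : ℕ) (d : ℕ → Delta f g) (hd : φ (d k) ≠ 0) :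
    Tendsto (fun m => ∫⁻ z, condCyl μX f z m k (fun i => (d i.1).1.1) *
        condCyl μY g z m k (fun i => (d i.1).1.2) ∂μZ) atTop
      (𝓝 (pathWeight αX PX αY PY αZ PZ f g k d * φ (d k))) := by
  rw [← tendsto_add_atTop_iff_nat k]
  simp_rw [add_comm _ k, lintegral_condCyl_mul hX hY hZ hf hg]
  exact ENNReal.Tendsto.const_mul (hφ (d k)) (Or.inl hd)

end Coupling

section Marginals

variable {A B C D : Type*} [Countable A] [MeasurableSpace A] [MeasurableSingletonClass A]

theorem measure_eq_of_cylinder_le {μ ν : Measure (ℕ → A)} [IsProbabilityMeasure μ]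
    [IsProbabilityMeasure ν]
    (h : ∀ (k : ℕ) (a : Fin (k + 1) → A),
      ν {ω | ∀ i : Fin (k + 1), ω i.1 = a i} ≤ μ {ω | ∀ i : Fin (k + 1), ω i.1 = a i}) :
    ν = μ := by
  have hfin : ∀ k, ν.map (fun ω (i : Fin (k + 1)) => ω i.1) =
      μ.map (fun ω (i : Fin (k + 1)) => ω i.1) := fun k => by
    have hT : Measurable fun (ω : ℕ → A) (i : Fin (k + 1)) => ω i.1 := by fun_prop
    have := Measure.isProbabilityMeasure_map (μ := ν) hT.aemeasurable
    have := Measure.isProbabilityMeasure_map (μ := μ) hT.aemeasurable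
    refine Measure.eq_of_le_of_measure_univ_eq (Measure.le_iff.2 fun s hs => ?_) (by simp)
    rw [Measure.map_apply hT hs, Measure.map_apply hT hs,
      ← tsum_measure_preimage_singleton s.to_countable
        fun y _ => hT (measurableSet_singleton y),
      ← tsum_measure_preimage_singleton s.to_countable
        fun y _ => hT (measurableSet_singleton y)]
    refine ENNReal.tsum_le_tsum fun a => ?_
    have he : (fun (ω : ℕ → A) (i : Fin (k + 1)) => ω i.1) ⁻¹' {a.1} =
        {ω | ∀ i : Fin (k + 1), ω i.1 = a.1 i} := by
      ext ω
      simp [funext_iff]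
    rw [he]
    exact h k a.1
  have hproj : IsProjectiveLimit ν fun I : Finset ℕ => μ.map I.restrict := fun I => by
    have hI : I.restrict (π := fun _ => A) =
        (fun (w : Fin (I.sup id + 1) → A) (i : I) =>
          w ⟨i.1, Nat.lt_succ_of_le (Finset.le_sup (f := id) i.2)⟩) ∘ fun ω i => ω i.1 := rfl
    rw [hI, ← Measure.map_map (by fun_prop) (by fun_prop), hfin,
      Measure.map_map (by fun_prop) (by fun_prop)]
    rfl
  have (I : Finset ℕ) : IsProbabilityMeasure (μ.map (I.restrict (π := fun _ => A))) :=
    Measure.isProbabilityMeasure_map (by fun_prop)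
  exact hproj.unique fun I => rfl

variable [Countable B] [MeasurableSpace B] [MeasurableSingletonClass B]
  [Countable C] [MeasurableSpace C] [MeasurableSingletonClass C]
  [Countable D] [MeasurableSpace D] [MeasurableSingletonClass D]
  {μX : Measure (ℕ → A)} {μY : Measure (ℕ → B)} {μZ : Measure (ℕ → C)} {μW : Measure (ℕ → D)}

theorem map_eq_of_tendsto_lintegral [IsProbabilityMeasure μX] [IsFiniteMeasure μZ]
    [IsProbabilityMeasure μW] {f : A → C} {g : B → C} {p : D → A} {q : D → B}
    (hpq : ∀ d e, p d = p e → q d = q e → d = e)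
    (hf : μX.map (fun ω n => f (ω n)) = μZ)
    (h : ∀ (k : ℕ) (d : Fin (k + 1) → D),
      Tendsto (fun m => ∫⁻ z, condCyl μX f z m k (fun i => p (d i)) *
        condCyl μY g z m k (fun i => q (d i)) ∂μZ) atTop
        (𝓝 (μW {ω | ∀ i : Fin (k + 1), ω i.1 = d i}))) :
    μW.map (fun ω n => p (ω n)) = μX := by
  have hp : Measurable p := measurable_of_countable p
  have hpm : Measurable fun (ω : ℕ → D) n => p (ω n) := by fun_prop
  have := Measure.isProbabilityMeasure_map (μ := μW) hpm.aemeasurable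
  refine measure_eq_of_cylinder_le fun k a => ?_
  set s : Set (Fin (k + 1) → D) := {d | ∀ i, p (d i) = a i} with hs
  have hT : Measurable fun (ω : ℕ → D) (i : Fin (k + 1)) => ω i.1 := by fun_prop
  have hpre : (fun (ω : ℕ → D) n => p (ω n)) ⁻¹' {ω | ∀ i : Fin (k + 1), ω i.1 = a i} =
      (fun (ω : ℕ → D) (i : Fin (k + 1)) => ω i.1) ⁻¹' s := rfl
  rw [Measure.map_apply hpm (measurableSet_forall_fin_eq k a), hpre,
    ← tsum_measure_preimage_singleton s.to_countable fun y _ => hT (measurableSet_singleton y)]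
  refine ENNReal.summable.tsum_le_of_sum_le fun t => ?_
  have hlim : Tendsto (fun m => ∑ d ∈ t, ∫⁻ z, condCyl μX f z m k (fun i => p (d.1 i)) *
        condCyl μY g z m k (fun i => q (d.1 i)) ∂μZ) atTop
      (𝓝 (∑ d ∈ t, μW ((fun (ω : ℕ → D) (i : Fin (k + 1)) => ω i.1) ⁻¹' {d.1}))) := by
    refine tendsto_finsetSum _ fun d _ => ?_
    convert h k d.1 using 3
    ext ω
    simp [funext_iff]
  refine le_of_tendsto hlim (eventually_atTop.2 ⟨k, fun m hm => ?_⟩)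
  obtain ⟨n, rfl⟩ := Nat.exists_eq_add_of_le hm
  have hinj : Function.Injective fun (d : s) (i : Fin (k + 1)) => q (d.1 i) := fun d e hde =>
    Subtype.ext (funext fun i => hpq _ _ ((d.2 i).trans (e.2 i).symm) (congrFun hde i))
  have hle := lintegral_condCyl_le hf n k fun i => a ⟨min i k, by omega⟩
  have ha : (fun i : Fin (k + 1) => a ⟨min i.1 k, by omega⟩) = a := by
    funext i
    congr 1
    exact Fin.ext (by simp; omega)
  rw [ha] at hle
  calc ∑ d ∈ t, ∫⁻ z, condCyl μX f z (k + n) k (fun i => p (d.1 i)) *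
        condCyl μY g z (k + n) k (fun i => q (d.1 i)) ∂μZ
      ≤ ∑' d : s, ∫⁻ z, condCyl μX f z (k + n) k a *
          condCyl μY g z (k + n) k (fun i => q (d.1 i)) ∂μZ := by
        refine le_of_eq_of_le (Finset.sum_congr rfl fun d _ => ?_) (ENNReal.sum_le_tsum t)
        rw [show (fun i => p (d.1 i)) = a from funext d.2]
    _ = ∫⁻ z, condCyl μX f z (k + n) k a *
          ∑' d : s, condCyl μY g z (k + n) k (fun i => q (d.1 i)) ∂μZ := by
        rw [← lintegral_tsum fun _ => ((measurable_condCyl μX f _ _ _).fun_mul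
          (measurable_condCyl μY g _ _ _)).aemeasurable]
        simp_rw [ENNReal.tsum_mul_left]
    _ ≤ ∫⁻ z, condCyl μX f z (k + n) k a ∂μZ :=
        lintegral_mono fun z => mul_le_of_le_one_right' <|
          (ENNReal.tsum_comp_le_tsum_of_injective hinj _).trans (tsum_condCyl_le_one μY g z _ k)
    _ ≤ μX {ω | ∀ i ≤ k, ω i = a ⟨min i k, by omega⟩} := hle
    _ = μX {ω | ∀ i : Fin (k + 1), ω i.1 = a i} := by
        congr 1
        ext ω
        simp only [Set.mem_ofPred_eq, Fin.forall_iff, Nat.lt_succ_iff]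
        exact forall₂_congr fun i hi => by simp [hi]

end Marginals

/-- **The marginals of `W = MC(α,P)` have the correct laws.** The coordinate projections of the
coupled chain `W = MC(α,P)` on `Δ'` have laws `X̄` and `Ȳ`, and every cylinder probability of
`W` is `E[L_∞(a_0,…,a_k) * M_∞(b_0,…,b_k)]`. -/
theorem statement_13
    {A B C : Type*} [Countable A] [Countable B] [Countable C]
    [MeasurableSpace A] [MeasurableSingletonClass A]
    [MeasurableSpace B] [MeasurableSingletonClass B]
    [MeasurableSpace C] [MeasurableSingletonClass C]
    (αX : A → ℝ≥0∞) (PX : A → A → ℝ≥0∞) (μX : Measure (ℕ → A))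
    (αY : B → ℝ≥0∞) (PY : B → B → ℝ≥0∞) (μY : Measure (ℕ → B))
    (αZ : C → ℝ≥0∞) (PZ : C → C → ℝ≥0∞) (μZ : Measure (ℕ → C))
    (f : A → C) (g : B → C)
    (hX : IsMarkovChain αX PX μX) (hY : IsMarkovChain αY PY μY)
    (hZ : IsMarkovChain αZ PZ μZ)
    (hfX : μX.map (fun ω n => f (ω n)) = μZ)
    (hgY : μY.map (fun ω n => g (ω n)) = μZ)
    (hAvis : ∀ a : A, ∃ t : ℕ, μX {ω | ω t = a} ≠ 0)
    (hBvis : ∀ b : B, ∃ t : ℕ, μY {ω | ω t = b} ≠ 0)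
    (φ : Delta f g → ℝ≥0∞)
    (hφ : ∀ d : Delta f g,
      Tendsto (fun m => phim (Rmat PX PY PZ f g) m d) atTop (𝓝 (φ d)))
    (μW : Measure (ℕ → {d : Delta f g // φ d ≠ 0}))
    (hW : IsMarkovChain (fun d => alphaW αX αY αZ f g φ d.1)
      (fun d e => Rmat PX PY PZ f g d.1 e.1 * φ e.1 / φ d.1) μW)
    (Linf : (ℕ → C) → (k : ℕ) → (Fin (k + 1) → A) → ℝ≥0∞)
    (Minf : (ℕ → C) → (k : ℕ) → (Fin (k + 1) → B) → ℝ≥0∞)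
    (hL : ∀ (k : ℕ) (a : Fin (k + 1) → A), ∀ᵐ z ∂μZ,
      Tendsto (fun m => condCyl μX f z m k a) atTop (𝓝 (Linf z k a)))
    (hM : ∀ (k : ℕ) (b : Fin (k + 1) → B), ∀ᵐ z ∂μZ,
      Tendsto (fun m => condCyl μY g z m k b) atTop (𝓝 (Minf z k b))) :
    μW.map (fun ω n => (ω n).1.1.1) = μX ∧
    μW.map (fun ω n => (ω n).1.1.2) = μY ∧
    ∀ (k : ℕ) (d : Fin (k + 1) → {d : Delta f g // φ d ≠ 0}),
      μW {ω | ∀ i : Fin (k + 1), ω i.1 = d i}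
        = ∫⁻ z, Linf z k (fun i => (d i).1.1.1) * Minf z k (fun i => (d i).1.1.2) ∂μZ := by
  have hlim : ∀ (k : ℕ) (d : Fin (k + 1) → {d : Delta f g // φ d ≠ 0}),
      Tendsto (fun m => ∫⁻ z, condCyl μX f z m k (fun i => (d i).1.1.1) *
        condCyl μY g z m k (fun i => (d i).1.1.2) ∂μZ) atTop
        (𝓝 (μW {ω | ∀ i : Fin (k + 1), ω i.1 = d i})) := fun k d => by
    have hd : ∀ i : Fin (k + 1), d ⟨min i.1 k, by omega⟩ = d i := fun i => by
      congr 1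
      exact Fin.ext (by simp; omega)
    have h := tendsto_lintegral_condCyl_mul hX hY hZ hfX hgY hφ k
      (fun i => (d ⟨min i k, by omega⟩).1) (d ⟨min k k, by omega⟩).2
    rw [← coupling_cylinder hW k fun i => d ⟨min i k, by omega⟩] at h
    simp only [hd] at h
    convert h using 3
    ext ω
    simp only [Set.mem_ofPred_eq, Fin.forall_iff, Nat.lt_succ_iff]
    exact forall₂_congr fun i hi => by simp [hi]
  have := hX.1
  have := hY.1
  have := hZ.1
  have := hW.1
  refine ⟨?_, ?_, fun k d => ?_⟩
  · exact map_eq_of_tendsto_lintegral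
      (fun d e h1 h2 => Subtype.ext (Subtype.ext (Prod.ext h1 h2))) hfX hlim
  · refine map_eq_of_tendsto_lintegral (μY := μX) (g := f) (q := fun d => d.1.1.1)
      (fun d e h1 h2 => Subtype.ext (Subtype.ext (Prod.ext h2 h1))) hgY fun k d => ?_
    simpa only [mul_comm] using hlim k d
  · refine tendsto_nhds_unique (hlim k d) (tendsto_lintegral_of_dominated_convergence 1
      (fun m => (measurable_condCyl μX f m k _).mul (measurable_condCyl μY g m k _))
      (fun m => ae_of_all _ fun z => mul_le_one' (condCyl_le_one μX f z m k _)
        (condCyl_le_one μY g z m k _)) (by simp) ?_)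
    filter_upwards [hL k fun i => (d i).1.1.1, hM k fun i => (d i).1.1.2] with z hzL hzM
    have hle : ∀ {x : ℝ≥0∞} {u : ℕ → ℝ≥0∞}, Tendsto u atTop (𝓝 x) → (∀ m, u m ≤ 1) → x ≠ ∞ :=
      fun hu hu1 => ((le_of_tendsto' hu hu1).trans_lt ENNReal.one_lt_top).ne
    exact ENNReal.Tendsto.mul hzL (Or.inr (hle hzM fun m => condCyl_le_one μY g z m k _))
      hzM (Or.inr (hle hzL fun m => condCyl_le_one μX f z m k _))
end

section
/- In the two-sided stationary setup, the vector π on Δ'' defined by π(a,b) = (π_X(a)·π_Y(b)/π_Z(c))·φ(a,b)·φ^rev(a,b) with c = f(a) = g(b) is a probability distribution on Δ''; the matrix P defined by P((a,b),(a',b')) = R((a,b),(a',b'))·φ(a',b')/φ(a,b) restricts to a row-stochastic matrix on Δ'' and satisfies πP = π; and the detailed balance relation π(a,b)·P((a,b),(a',b')) = π(a',b')·P^rev((a',b'),(a,b)) holds for all (a,b),(a',b') ∈ Δ'', where P^rev((a,b),(a',b')) = R^rev((a,b),(a',b'))·φ^rev(a',b')/φ^rev(a,b). -/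
open MeasureTheory Filter Topology
open scoped ENNReal Classical

/-- `μ` is the law on two-sided path space of a stationary time-homogeneous Markov chain with
stationary one-dimensional distribution `π` and transition matrix `P`. -/
def IsStatMarkovChainZ {U : Type*} [MeasurableSpace U]
    (π : U → ℝ≥0∞) (P : U → U → ℝ≥0∞) (μ : Measure (ℤ → U)) : Prop :=
  IsProbabilityMeasure μ ∧ IsProbVec π ∧ IsStochastic P ∧
    ∀ (t : ℤ) (k : ℕ) (a : ℕ → U),
      μ {ω | ∀ i ≤ k, ω (t + (i : ℤ)) = a i}
        = π (a 0) * ∏ i ∈ Finset.range k, P (a i) (a (i + 1))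

/-- The transition matrix of the time reversal: `P^rev(x',x) = π(x) P(x,x') / π(x')`. -/
noncomputable def revMat {U : Type*} (π : U → ℝ≥0∞) (P : U → U → ℝ≥0∞) (x' x : U) : ℝ≥0∞ :=
  π x * P x x' / π x'

/-- The stationary distribution of the coupled chain on `Δ''`:
`π(a,b) = (π_X(a) π_Y(b) / π_Z(c)) * φ(a,b) * φ^rev(a,b)`. -/
noncomputable def piW {A B C : Type*} (πX : A → ℝ≥0∞) (πY : B → ℝ≥0∞) (πZ : C → ℝ≥0∞)
    (f : A → C) (g : B → C) (φ φr : Delta f g → ℝ≥0∞) (d : Delta f g) : ℝ≥0∞ :=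
  πX d.1.1 * πY d.1.2 / πZ (f d.1.1) * φ d * φr d

/-! ### Sums and limits in `[0,∞]` -/

theorem ennreal_tendsto_tsum_of_dominated {ι : Type*} {u : ℕ → ι → ℝ≥0∞} {v bound : ι → ℝ≥0∞}
    (hle : ∀ k i, u k i ≤ bound i) (hbound : ∑' i, bound i ≠ ⊤)
    (hlim : ∀ i, Tendsto (fun k => u k i) atTop (𝓝 (v i))) :
    Tendsto (fun k => ∑' i, u k i) atTop (𝓝 (∑' i, v i)) := by
  let _ : MeasurableSpace ι := ⊤
  have h := tendsto_lintegral_of_dominated_convergence (μ := Measure.count) (F := u) (f := v) bound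
    (fun _ => measurable_from_top) (fun k => Eventually.of_forall (hle k))
    (by rwa [lintegral_count]) (Eventually.of_forall hlim)
  simpa only [lintegral_count] using h

theorem ennreal_tsum_le_of_tendsto {ι : Type*} {u : ℕ → ι → ℝ≥0∞} {v : ι → ℝ≥0∞}
    {s : ℕ → ℝ≥0∞} {l : ℝ≥0∞} (hlim : ∀ i, Tendsto (fun k => u k i) atTop (𝓝 (v i)))
    (hs : ∀ k, ∑' i, u k i ≤ s k) (hl : Tendsto s atTop (𝓝 l)) : ∑' i, v i ≤ l := by
  rw [ENNReal.tsum_eq_iSup_sum]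
  refine iSup_le fun t => le_of_tendsto_of_tendsto' (tendsto_finsetSum t fun i _ => hlim i) hl
    fun k => (ENNReal.sum_le_tsum t).trans (hs k)

theorem ennreal_eq_of_tsum_eq {ι : Type*} {u v : ι → ℝ≥0∞} (hle : ∀ i, u i ≤ v i)
    (hsum : ∑' i, u i = ∑' i, v i) (hfin : ∑' i, v i ≠ ⊤) (i : ι) : u i = v i := by
  by_contra hne
  exact (ENNReal.tsum_lt_tsum (hsum ▸ hfin) hle (lt_of_le_of_ne (hle i) hne)).ne hsum

/-! ### Kernels in duality and the `h`-transform -/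

section Duality

variable {D : Type*} {q φ φ' : D → ℝ≥0∞} {R R' : D → D → ℝ≥0∞}

theorem tsum_mul_limit_phim_eq (hq0 : ∀ d, q d ≠ 0) (hqt : ∀ d, q d ≠ ⊤)
    (hdual : ∀ d e, q d * R d e = q e * R' e d)
    (hφ : ∀ d, Tendsto (fun m => phim R m d) atTop (𝓝 (φ d)))
    (hRt : ∀ d e, R d e ≠ ⊤)
    (h0 : ∑' d, q d * φ d = 1) (h1 : ∑' d, q d * phim R' 1 d * φ d = 1) (d : D) :
    ∑' e, R d e * φ e = φ d := by
  have hle : ∀ d, ∑' e, R d e * φ e ≤ φ d := fun d =>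
    ennreal_tsum_le_of_tendsto (u := fun k e => R d e * phim R k e)
      (s := fun k => phim R (k + 1) d)
      (fun e => ENNReal.Tendsto.const_mul (hφ e) (Or.inr (hRt d e))) (fun k => le_rfl)
      ((tendsto_add_atTop_iff_nat 1).2 (hφ d))
  have hs : ∑' d, q d * ∑' e, R d e * φ e = ∑' d, q d * φ d := by
    rw [h0, ← h1]
    simp_rw [← ENNReal.tsum_mul_left]
    rw [ENNReal.tsum_comm]
    refine tsum_congr fun e => ?_
    simp_rw [← mul_assoc, hdual _ e, phim, mul_one]
    rw [ENNReal.tsum_mul_right, ENNReal.tsum_mul_left]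
  have h := ennreal_eq_of_tsum_eq (fun d => mul_le_mul_right (hle d) (q d)) hs (by simp [h0]) d
  exact (ENNReal.mul_right_inj (hq0 d) (hqt d)).1 h

theorem tsum_transform_eq_one (hq0 : ∀ d, q d ≠ 0)
    (hdual : ∀ d e, q d * R d e = q e * R' e d)
    (harm : ∀ d, ∑' e, R d e * φ e = φ d) (harm' : ∀ d, ∑' e, R' d e * φ' e = φ' d)
    (hfin : ∀ d, φ d ≠ ⊤) (s : Set D) (hs : ∀ e, φ e ≠ 0 → φ' e ≠ 0 → e ∈ s)
    {d : D} (hd : φ d ≠ 0) (hd' : φ' d ≠ 0) :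
    ∑' e : s, R d e.1 * φ e.1 / φ d = 1 := by
  rw [tsum_subtype_eq_of_support_subset (f := fun e => R d e * φ e / φ d)]
  · simp_rw [div_eq_mul_inv]
    rw [ENNReal.tsum_mul_right, harm, ENNReal.mul_inv_cancel hd (hfin d)]
  · intro e he
    have hne : R d e * φ e ≠ 0 := fun h => he (by simp [h])
    refine hs e (right_ne_zero_of_mul hne) fun h => ?_
    have hR' : R' e d ≠ 0 := by
      refine right_ne_zero_of_mul (a := q e) ?_
      rw [← hdual]
      exact mul_ne_zero (hq0 d) (left_ne_zero_of_mul hne)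
    have := harm' e
    rw [h, ENNReal.tsum_eq_zero] at this
    exact mul_ne_zero hR' hd' (this d)

theorem transform_detailed_balance (hdual : ∀ d e, q d * R d e = q e * R' e d)
    {d e : D} (hd : φ d ≠ 0) (hdt : φ d ≠ ⊤) (he : φ' e ≠ 0) (het : φ' e ≠ ⊤) :
    q d * φ d * φ' d * (R d e * φ e / φ d) = q e * φ e * φ' e * (R' e d * φ' d / φ' e) := by
  have h1 : q d * φ d * φ' d * (R d e * φ e / φ d) = q d * R d e * φ e * φ' d := by
    calc _ = q d * R d e * φ e * φ' d * (φ d * (φ d)⁻¹) := by rw [div_eq_mul_inv]; ring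
      _ = _ := by rw [ENNReal.mul_inv_cancel hd hdt, mul_one]
  have h2 : q e * φ e * φ' e * (R' e d * φ' d / φ' e) = q e * R' e d * φ e * φ' d := by
    calc _ = q e * R' e d * φ e * φ' d * (φ' e * (φ' e)⁻¹) := by rw [div_eq_mul_inv]; ring
      _ = _ := by rw [ENNReal.mul_inv_cancel he het, mul_one]
  rw [h1, h2, hdual]

end Duality

/-! ### Observing a chain through a function -/

/-- `wordProb P g z b` is the probability that a chain with transition matrix `P` started at `b`
has its next observations through `g` equal to the word `z`. -/
noncomputable def wordProb {B C : Type*} (P : B → B → ℝ≥0∞) (g : B → C) : List C → B → ℝ≥0∞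
  | [] => fun _ => 1
  | z :: zs => fun b => ∑' b' : {b' // z = g b'}, P b b'.1 * wordProb P g zs b'.1

theorem wordProb_id_cons {C : Type*} (P : C → C → ℝ≥0∞) (z : C) (zs : List C) (c : C) :
    wordProb P id (z :: zs) c = P c z * wordProb P id zs z :=
  tsum_eq_single (⟨z, rfl⟩ : {c' // z = id c'}) fun b hb => absurd (Subtype.ext b.2.symm) hb

/-- The paths whose observations through `g` from time `t` on start with the given word. -/
def wordEvent {B C : Type*} (g : B → C) : ℤ → List C → Set (ℤ → B)
  | _, [] => Set.univ
  | t, z :: zs => {ω | z = g (ω t)} ∩ wordEvent g (t + 1) zs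

theorem measurableSet_wordEvent {B C : Type*} [Countable B] [MeasurableSpace B]
    [MeasurableSingletonClass B] (g : B → C) (t : ℤ) (z : List C) :
    MeasurableSet (wordEvent g t z) := by
  induction z generalizing t with
  | nil => exact MeasurableSet.univ
  | cons z zs ih =>
    exact ((measurable_pi_apply t) (Set.to_countable {b | z = g b}).measurableSet).inter (ih _)

theorem preimage_wordEvent {B C : Type*} (g : B → C) (t : ℤ) (z : List C) :
    (fun (ω : ℤ → B) (n : ℤ) => g (ω n)) ⁻¹' wordEvent id t z = wordEvent g t z := by
  induction z generalizing t with
  | nil => rfl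
  | cons z zs ih => rw [wordEvent, wordEvent, Set.preimage_inter, ih]; rfl

theorem measure_eq_tsum_fiber {Ω B : Type*} [Countable B] [MeasurableSpace Ω] [MeasurableSpace B]
    [MeasurableSingletonClass B] (μ : Measure Ω) {X : Ω → B} (hX : Measurable X)
    (p : B → Prop) {s : Set Ω} (hs : MeasurableSet s) :
    μ ({ω | p (X ω)} ∩ s) = ∑' b : {b // p b}, μ ({ω | X ω = b.1} ∩ s) := by
  rw [← measure_iUnion]
  · congr 1
    ext ω
    simp
  · intro b b' hbb'
    refine Set.disjoint_left.2 fun ω h h' => hbb' (Subtype.ext ?_)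
    exact h.1.symm.trans h'.1
  · exact fun b => (hX (measurableSet_singleton b.1)).inter hs

section Chain

variable {U V : Type*} [MeasurableSpace U]
  {π : U → ℝ≥0∞} {P : U → U → ℝ≥0∞} {μ : Measure (ℤ → U)}

theorem IsStatMarkovChainZ.stationary_ne_top (h : IsStatMarkovChainZ π P μ) (x : U) :
    π x ≠ ⊤ :=
  ENNReal.ne_top_of_tsum_ne_top (by rw [h.2.1]; simp) x

theorem IsStatMarkovChainZ.transition_ne_top (h : IsStatMarkovChainZ π P μ) (x y : U) :
    P x y ≠ ⊤ :=
  ENNReal.ne_top_of_tsum_ne_top (by rw [h.2.2.1 x]; simp) y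

theorem mul_revMat (hπ0 : ∀ x, π x ≠ 0) (h : IsStatMarkovChainZ π P μ) (x y : U) :
    π y * revMat π P y x = π x * P x y :=
  ENNReal.mul_div_cancel (hπ0 y) (h.stationary_ne_top y)

variable [Countable U] [MeasurableSingletonClass U]

theorem measure_prefix_inter_wordEvent (h : IsStatMarkovChainZ π P μ) (g : U → V)
    (z : List V) (k : ℕ) (a : ℕ → U) :
    μ ({ω | ∀ i ≤ k, ω (i : ℤ) = a i} ∩ wordEvent g ((k : ℤ) + 1) z)
      = (π (a 0) * ∏ i ∈ Finset.range k, P (a i) (a (i + 1))) * wordProb P g z (a k) := by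
  induction z generalizing k a with
  | nil =>
    have := h.2.2.2 0 k a
    simp only [zero_add] at this
    rw [wordEvent, Set.inter_univ, this, wordProb, mul_one]
  | cons z zs ih =>
    have hm : MeasurableSet ({ω : ℤ → U | ∀ i ≤ k, ω (i : ℤ) = a i}
        ∩ wordEvent g ((k : ℤ) + 1 + 1) zs) := by
      refine MeasurableSet.inter ?_ (measurableSet_wordEvent _ _ _)
      simp only [Set.ofPred_forall]
      exact MeasurableSet.iInter fun i => MeasurableSet.iInter fun _ =>
        (measurableSet_singleton (a i)).preimage (measurable_pi_apply (i : ℤ))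
    rw [wordEvent, Set.inter_left_comm,
      measure_eq_tsum_fiber μ (measurable_pi_apply ((k : ℤ) + 1)) (fun u => z = g u) hm, wordProb,
      ← ENNReal.tsum_mul_left]
    refine tsum_congr fun b => ?_
    have hk := ih (k + 1) (Function.update a (k + 1) b.1)
    have hset : {ω : ℤ → U | ω ((k : ℤ) + 1) = b.1} ∩ ({ω | ∀ i ≤ k, ω (i : ℤ) = a i}
          ∩ wordEvent g ((k : ℤ) + 1 + 1) zs)
        = {ω | ∀ i ≤ k + 1, ω (i : ℤ) = Function.update a (k + 1) b.1 i}
          ∩ wordEvent g (((k + 1 : ℕ) : ℤ) + 1) zs := by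
      rw [← Set.inter_assoc]
      congr 1
      · ext ω
        simp only [Set.mem_inter_iff, Set.mem_ofPred_eq, Nat.le_succ_iff, or_imp, forall_and,
          forall_eq, Function.update_self]
        rw [and_comm]
        refine and_congr (forall₂_congr fun i hi => ?_) (by push_cast; rfl)
        rw [Function.update_of_ne (by omega)]
    rw [hset, hk, Finset.prod_range_succ, Function.update_self,
      Function.update_of_ne (by omega : k ≠ k + 1), Function.update_of_ne (by omega : 0 ≠ k + 1),
      Finset.prod_congr rfl fun i hi => ?_]
    · ring
    · have := Finset.mem_range.1 hi
      rw [Function.update_of_ne (by omega), Function.update_of_ne (by omega)]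

theorem measure_wordEvent_cons (h : IsStatMarkovChainZ π P μ) (g : U → V) (c : V) (z : List V) :
    μ (wordEvent g 0 (c :: z)) = ∑' b : {b // c = g b}, π b.1 * wordProb P g z b.1 := by
  rw [wordEvent, measure_eq_tsum_fiber μ (measurable_pi_apply (0 : ℤ)) (fun u => c = g u)
    (measurableSet_wordEvent _ _ _)]
  refine tsum_congr fun b => ?_
  simpa using measure_prefix_inter_wordEvent h g z 0 (fun _ => b.1)

theorem tsum_stationary_mul (h : IsStatMarkovChainZ π P μ) (y : U) :
    ∑' x, π x * P x y = π y := by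
  have h1 : μ {ω | ω 1 = y} = π y := by simpa using h.2.2.2 1 0 (fun _ => y)
  have hm : MeasurableSet {ω : ℤ → U | ω 1 = y} :=
    (measurableSet_singleton y).preimage (measurable_pi_apply (1 : ℤ))
  rw [← h1, ← Set.univ_inter {ω : ℤ → U | ω 1 = y}]
  have h2 := measure_eq_tsum_fiber μ (measurable_pi_apply (0 : ℤ)) (fun _ : U => True) hm
  simp only [Set.ofPred_true] at h2
  rw [h2, ← (Equiv.subtypeUnivEquiv (fun _ : U => trivial)).tsum_eq]
  refine tsum_congr fun b => ?_
  have h3 := h.2.2.2 0 1 (fun i => if i = 0 then b.1 else y)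
  simp only [Finset.range_one, Finset.prod_singleton, if_true, zero_add, one_ne_zero,
    if_false] at h3
  rw [Equiv.subtypeUnivEquiv_apply, ← h3]
  congr 1
  ext ω
  simp [Nat.le_one_iff_eq_zero_or_eq_one]

theorem isStochastic_revMat (hπ0 : ∀ x, π x ≠ 0) (h : IsStatMarkovChainZ π P μ) :
    IsStochastic (revMat π P) := by
  intro y
  simp_rw [revMat, div_eq_mul_inv]
  rw [ENNReal.tsum_mul_right, tsum_stationary_mul h,
    ENNReal.mul_inv_cancel (hπ0 y) (h.stationary_ne_top y)]

variable [Countable V] [MeasurableSpace V] [MeasurableSingletonClass V]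
  {ρ : V → ℝ≥0∞} {Q : V → V → ℝ≥0∞} {ν : Measure (ℤ → V)} {g : U → V}

theorem tsum_stationary_wordProb (hU : IsStatMarkovChainZ π P μ) (hV : IsStatMarkovChainZ ρ Q ν)
    (hg : μ.map (fun ω (n : ℤ) => g (ω n)) = ν) (c : V) (z : List V) :
    ∑' b : {b // c = g b}, π b.1 * wordProb P g z b.1 = ρ c * wordProb Q id z c := by
  have hgm : Measurable g := measurable_of_countable g
  have hmeas : Measurable (fun (ω : ℤ → U) (n : ℤ) => g (ω n)) :=
    measurable_pi_lambda _ fun n => hgm.comp (measurable_pi_apply n)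
  rw [← measure_wordEvent_cons hU g, ← preimage_wordEvent,
    ← Measure.map_apply hmeas (measurableSet_wordEvent _ _ _), hg, measure_wordEvent_cons hV]
  exact tsum_eq_single (⟨c, rfl⟩ : {c' // c = id c'}) fun b hb => absurd (Subtype.ext b.2.symm) hb

theorem transition_image_ne_zero (hU : IsStatMarkovChainZ π P μ) (hV : IsStatMarkovChainZ ρ Q ν)
    (hπ0 : ∀ x, π x ≠ 0) (hg : μ.map (fun ω (n : ℤ) => g (ω n)) = ν) {x y : U}
    (hxy : P x y ≠ 0) : Q (g x) (g y) ≠ 0 := by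
  intro h0
  have h := tsum_stationary_wordProb hU hV hg (g x) [g y]
  rw [wordProb_id_cons, h0, zero_mul, mul_zero, ENNReal.tsum_eq_zero] at h
  have h1 := (mul_eq_zero.1 (h ⟨x, rfl⟩)).resolve_left (hπ0 x)
  rw [wordProb, ENNReal.tsum_eq_zero] at h1
  have h2 := h1 ⟨y, rfl⟩
  rw [wordProb, mul_one] at h2
  exact hxy h2

theorem revMat_image_ne_zero (hU : IsStatMarkovChainZ π P μ) (hV : IsStatMarkovChainZ ρ Q ν)
    (hπ0 : ∀ x, π x ≠ 0) (hρ0 : ∀ x, ρ x ≠ 0) (hg : μ.map (fun ω (n : ℤ) => g (ω n)) = ν)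
    {x y : U} (hxy : revMat π P x y ≠ 0) : revMat ρ Q (g x) (g y) ≠ 0 := by
  have h : P y x ≠ 0 := fun h => hxy (by simp [revMat, h])
  exact ENNReal.div_ne_zero.2 ⟨mul_ne_zero (hρ0 _) (transition_image_ne_zero hU hV hπ0 hg h),
    hV.stationary_ne_top _⟩

/-- The two-sided observation law of the hidden chain agrees with that of the image chain. -/
theorem tsum_stationary_wordProb_revMat (hU : IsStatMarkovChainZ π P μ)
    (hV : IsStatMarkovChainZ ρ Q ν) (hπ0 : ∀ x, π x ≠ 0) (hρ0 : ∀ x, ρ x ≠ 0)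
    (hg : μ.map (fun ω (n : ℤ) => g (ω n)) = ν) (w : List V) (c : V) (z : List V) :
    ∑' b : {b // c = g b}, π b.1 * wordProb P g z b.1 * wordProb (revMat π P) g w b.1
      = ρ c * wordProb Q id z c * wordProb (revMat ρ Q) id w c := by
  induction w generalizing c z with
  | nil =>
    simp_rw [wordProb, mul_one]
    exact tsum_stationary_wordProb hU hV hg c z
  | cons w ws ih =>
    have h := ih w (c :: z)
    rw [wordProb_id_cons] at h
    rw [wordProb_id_cons]
    calc _ = ∑' b : {b // c = g b}, ∑' b' : {b' // w = g b'},
          π b'.1 * (P b'.1 b.1 * wordProb P g z b.1) * wordProb (revMat π P) g ws b'.1 := by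
          refine tsum_congr fun b => ?_
          rw [wordProb, ← ENNReal.tsum_mul_left]
          refine tsum_congr fun b' => ?_
          rw [← mul_assoc (π b'.1), ← mul_revMat hπ0 hU]
          ring
      _ = ∑' b' : {b' // w = g b'}, π b'.1 * wordProb P g (c :: z) b'.1
            * wordProb (revMat π P) g ws b'.1 := by
          rw [ENNReal.tsum_comm]
          refine tsum_congr fun b' => ?_
          rw [ENNReal.tsum_mul_right, ENNReal.tsum_mul_left]
          rfl
      _ = _ := by
          rw [h, ← mul_assoc (ρ w), ← mul_revMat hρ0 hV]
          ring

end Chain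

/-! ### The kernel on the fibre product -/

section FibreProduct

variable {A B C : Type*} {PX : A → A → ℝ≥0∞} {PY : B → B → ℝ≥0∞} {PZ : C → C → ℝ≥0∞}
  {f : A → C} {g : B → C}

theorem tsum_delta (F : Delta f g → ℝ≥0∞) :
    ∑' e, F e = ∑' a, ∑' b : {b // f a = g b}, F ⟨(a, b.1), b.2⟩ := by
  rw [← (Equiv.subtypeProdEquivSigmaSubtype (fun a b => f a = g b)).symm.tsum_eq,
    ENNReal.tsum_sigma']
  rfl

theorem Rmat_eq_mul (habs : ∀ x y, PX x y ≠ 0 → PZ (f x) (f y) ≠ 0) (d e : Delta f g) :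
    Rmat PX PY PZ f g d e
      = PX d.1.1 e.1.1 * (PZ (f d.1.1) (f e.1.1))⁻¹ * PY d.1.2 e.1.2 := by
  rw [Rmat]
  split_ifs with h
  · rw [div_eq_mul_inv]; ring
  · have : PX d.1.1 e.1.1 = 0 := by_contra fun h' => h (habs _ _ h')
    simp [this]

theorem Rmat_ne_top (hX : IsStochastic PX) (hY : IsStochastic PY) (d e : Delta f g) :
    Rmat PX PY PZ f g d e ≠ ⊤ := by
  rw [Rmat]
  split_ifs with h
  · exact ENNReal.div_ne_top (ENNReal.mul_ne_top
      (ENNReal.ne_top_of_tsum_ne_top (by rw [hX]; simp) _)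
      (ENNReal.ne_top_of_tsum_ne_top (by rw [hY]; simp) _)) h
  · simp

theorem tsum_fiber_mul_phim (hX : IsStochastic PX)
    (habs : ∀ x y, PX x y ≠ 0 → PZ (f x) (f y) ≠ 0) (hZt : ∀ c c', PZ c c' ≠ ⊤)
    (m : ℕ) (a : A) (v : B → ℝ≥0∞) (κ : ℝ≥0∞)
    (hv : ∀ z, ∑' b : {b // f a = g b}, v b.1 * wordProb PY g z b.1
      = κ * wordProb PZ id z (f a)) :
    ∑' b : {b // f a = g b}, v b.1 * phim (Rmat PX PY PZ f g) m ⟨(a, b.1), b.2⟩ = κ := by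
  induction m generalizing a v κ with
  | zero => simpa [wordProb, phim] using hv []
  | succ m ih =>
    have key : ∀ a', ∑' b' : {b' // f a' = g b'},
        (∑' b : {b // f a = g b}, v b.1 * PY b.1 b'.1)
          * phim (Rmat PX PY PZ f g) m ⟨(a', b'.1), b'.2⟩ = κ * PZ (f a) (f a') := by
      intro a'
      refine ih a' (fun b' => ∑' b : {b // f a = g b}, v b.1 * PY b.1 b') _ fun z => ?_
      have h := hv (f a' :: z)
      rw [wordProb_id_cons, ← mul_assoc] at h
      rw [← h]
      simp_rw [← ENNReal.tsum_mul_right]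
      rw [ENNReal.tsum_comm]
      refine tsum_congr fun b => ?_
      rw [wordProb, ← ENNReal.tsum_mul_left]
      exact tsum_congr fun b' => mul_assoc _ _ _
    calc _ = ∑' b : {b // f a = g b}, ∑' a', ∑' b' : {b' // f a' = g b'},
          PX a a' * (PZ (f a) (f a'))⁻¹ * (v b.1 * PY b.1 b'.1
            * phim (Rmat PX PY PZ f g) m ⟨(a', b'.1), b'.2⟩) := by
          refine tsum_congr fun b => ?_
          simp only [phim]
          rw [tsum_delta, ← ENNReal.tsum_mul_left]
          refine tsum_congr fun a' => ?_
          rw [← ENNReal.tsum_mul_left]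
          refine tsum_congr fun b' => ?_
          rw [Rmat_eq_mul habs]
          ring
      _ = ∑' a', PX a a' * (PZ (f a) (f a'))⁻¹ * (κ * PZ (f a) (f a')) := by
          rw [ENNReal.tsum_comm]
          refine tsum_congr fun a' => ?_
          rw [← key a', ENNReal.tsum_comm, ← ENNReal.tsum_mul_left]
          refine tsum_congr fun b' => ?_
          rw [ENNReal.tsum_mul_left, ENNReal.tsum_mul_right]
      _ = ∑' a', PX a a' * κ := by
          refine tsum_congr fun a' => ?_
          by_cases h : PX a a' = 0
          · simp [h]
          · calc _ = PX a a' * κ * (PZ (f a) (f a') * (PZ (f a) (f a'))⁻¹) := by ring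
              _ = _ := by rw [ENNReal.mul_inv_cancel (habs _ _ h) (hZt _ _), mul_one]
      _ = κ := by rw [ENNReal.tsum_mul_right, hX a, one_mul]

/-- Exchanging the two coordinates of the fibre product. -/
def deltaSwap (f : A → C) (g : B → C) : Delta f g ≃ Delta g f where
  toFun d := ⟨(d.1.2, d.1.1), d.2.symm⟩
  invFun d := ⟨(d.1.2, d.1.1), d.2.symm⟩
  left_inv _ := rfl
  right_inv _ := rfl

theorem phim_deltaSwap (m : ℕ) (d : Delta f g) :
    phim (Rmat PY PX PZ g f) m (deltaSwap f g d) = phim (Rmat PX PY PZ f g) m d := by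
  induction m generalizing d with
  | zero => rfl
  | succ m ih =>
    simp only [phim]
    rw [← (deltaSwap f g).tsum_eq]
    refine tsum_congr fun e => ?_
    rw [ih]
    congr 1
    simp only [Rmat, deltaSwap, Equiv.coe_fn_mk, ← d.2, ← e.2, mul_comm]

end FibreProduct

section Coupling

variable {A B C : Type*} [Countable A] [Countable C]
  [MeasurableSpace A] [MeasurableSingletonClass A]
  [MeasurableSpace B]
  [MeasurableSpace C] [MeasurableSingletonClass C]
  {πX : A → ℝ≥0∞} {PX : A → A → ℝ≥0∞} {μX : Measure (ℤ → A)}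
  {πY : B → ℝ≥0∞} {PY : B → B → ℝ≥0∞} {μY : Measure (ℤ → B)}
  {πZ : C → ℝ≥0∞} {PZ : C → C → ℝ≥0∞} {μZ : Measure (ℤ → C)}
  {f : A → C} {g : B → C}

theorem Rmat_duality (hX : IsStatMarkovChainZ πX PX μX) (hY : IsStatMarkovChainZ πY PY μY)
    (hZ : IsStatMarkovChainZ πZ PZ μZ)
    (hπX : ∀ a : A, πX a ≠ 0) (hπY : ∀ b : B, πY b ≠ 0) (hπZ : ∀ c : C, πZ c ≠ 0)
    (hfX : μX.map (fun ω (n : ℤ) => f (ω n)) = μZ) (d e : Delta f g) :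
    πX d.1.1 * πY d.1.2 / πZ (f d.1.1) * Rmat PX PY PZ f g d e
      = πX e.1.1 * πY e.1.2 / πZ (f e.1.1)
        * Rmat (revMat πX PX) (revMat πY PY) (revMat πZ PZ) f g e d := by
  rw [Rmat_eq_mul (PX := PX) (f := f) fun _ _ => transition_image_ne_zero hX hZ hπX hfX,
    Rmat_eq_mul (PX := revMat πX PX) (f := f) fun _ _ => revMat_image_ne_zero hX hZ hπX hπZ hfX]
  have hz : (πZ (f e.1.1))⁻¹ * (revMat πZ PZ (f e.1.1) (f d.1.1))⁻¹
      = (πZ (f d.1.1))⁻¹ * (PZ (f d.1.1) (f e.1.1))⁻¹ := by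
    rw [← ENNReal.mul_inv (Or.inl (hπZ _)) (Or.inl (hZ.stationary_ne_top _)),
      ← ENNReal.mul_inv (Or.inl (hπZ _)) (Or.inl (hZ.stationary_ne_top _)), mul_revMat hπZ hZ]
  calc _ = (πX d.1.1 * PX d.1.1 e.1.1) * (πY d.1.2 * PY d.1.2 e.1.2)
        * ((πZ (f d.1.1))⁻¹ * (PZ (f d.1.1) (f e.1.1))⁻¹) := by rw [div_eq_mul_inv]; ring
    _ = _ := by rw [← hz, ← mul_revMat hπX hX, ← mul_revMat hπY hY, div_eq_mul_inv]; ring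

variable [Countable B] [MeasurableSingletonClass B]

/-- Truncations to finite windows of the relatively independent coupling have first
marginal `πX`. -/
theorem tsum_fiber_piW_phim (hX : IsStatMarkovChainZ πX PX μX) (hY : IsStatMarkovChainZ πY PY μY)
    (hZ : IsStatMarkovChainZ πZ PZ μZ)
    (hπX : ∀ a : A, πX a ≠ 0) (hπY : ∀ b : B, πY b ≠ 0) (hπZ : ∀ c : C, πZ c ≠ 0)
    (hfX : μX.map (fun ω (n : ℤ) => f (ω n)) = μZ)
    (hgY : μY.map (fun ω (n : ℤ) => g (ω n)) = μZ) (m n : ℕ) (a : A) :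
    ∑' b : {b // f a = g b}, piW πX πY πZ f g (phim (Rmat PX PY PZ f g) m)
      (phim (Rmat (revMat πX PX) (revMat πY PY) (revMat πZ PZ) f g) n) ⟨(a, b.1), b.2⟩
      = πX a := by
  have hrev : ∀ z, ∑' b : {b // f a = g b}, (πY b.1 * wordProb PY g z b.1)
      * phim (Rmat (revMat πX PX) (revMat πY PY) (revMat πZ PZ) f g) n ⟨(a, b.1), b.2⟩
      = πZ (f a) * wordProb PZ id z (f a) := fun z =>
    tsum_fiber_mul_phim (isStochastic_revMat hπX hX)
      (fun _ _ => revMat_image_ne_zero hX hZ hπX hπZ hfX)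
      (fun c c' => ENNReal.ne_top_of_tsum_ne_top
        (by rw [isStochastic_revMat hπZ hZ c]; simp) c')
      n a (fun b => πY b * wordProb PY g z b) _
      fun w => tsum_stationary_wordProb_revMat hY hZ hπY hπZ hgY w (f a) z
  let v : B → ℝ≥0∞ := fun b => if h : f a = g b then
    πY b * phim (Rmat (revMat πX PX) (revMat πY PY) (revMat πZ PZ) f g) n ⟨(a, b), h⟩ else 0
  have hv : ∀ b : {b // f a = g b}, v b.1 = πY b.1
      * phim (Rmat (revMat πX PX) (revMat πY PY) (revMat πZ PZ) f g) n ⟨(a, b.1), b.2⟩ :=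
    fun b => dif_pos b.2
  have hfwd := tsum_fiber_mul_phim hX.2.2.1 (fun _ _ => transition_image_ne_zero hX hZ hπX hfX)
    hZ.transition_ne_top m a v (πZ (f a)) fun z => by
      rw [← hrev z]
      refine tsum_congr fun b => ?_
      rw [hv]
      ring
  calc _ = ∑' b : {b // f a = g b}, πX a * (πZ (f a))⁻¹
        * (v b.1 * phim (Rmat PX PY PZ f g) m ⟨(a, b.1), b.2⟩) := by
        refine tsum_congr fun b => ?_
        rw [hv, piW, div_eq_mul_inv]
        ring
    _ = πX a * ((πZ (f a))⁻¹ * πZ (f a)) := by rw [ENNReal.tsum_mul_left, hfwd, mul_assoc]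
    _ = πX a := by rw [ENNReal.inv_mul_cancel (hπZ _) (hZ.stationary_ne_top _), mul_one]

theorem piW_phim_le (hX : IsStatMarkovChainZ πX PX μX) (hY : IsStatMarkovChainZ πY PY μY)
    (hZ : IsStatMarkovChainZ πZ PZ μZ)
    (hπX : ∀ a : A, πX a ≠ 0) (hπY : ∀ b : B, πY b ≠ 0) (hπZ : ∀ c : C, πZ c ≠ 0)
    (hfX : μX.map (fun ω (n : ℤ) => f (ω n)) = μZ)
    (hgY : μY.map (fun ω (n : ℤ) => g (ω n)) = μZ) (m n : ℕ) (d : Delta f g) :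
    piW πX πY πZ f g (phim (Rmat PX PY PZ f g) m)
      (phim (Rmat (revMat πX PX) (revMat πY PY) (revMat πZ PZ) f g) n) d ≤ πY d.1.2 := by
  have h := tsum_fiber_piW_phim hY hX hZ hπY hπX hπZ hgY hfX m n d.1.2
  rw [← h]
  refine le_trans (le_of_eq ?_) (ENNReal.le_tsum ⟨d.1.1, d.2.symm⟩)
  have hs := fun m => phim_deltaSwap (PX := PX) (PY := PY) (PZ := PZ) m d
  have hs' := fun m => phim_deltaSwap (PX := revMat πX PX) (PY := revMat πY PY)
    (PZ := revMat πZ PZ) m d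
  simp only [deltaSwap, Equiv.coe_fn_mk] at hs hs'
  simp only [piW, hs, hs', ← d.2, mul_comm (πX _)]

theorem tsum_piW_limit_eq_one (hX : IsStatMarkovChainZ πX PX μX)
    (hY : IsStatMarkovChainZ πY PY μY) (hZ : IsStatMarkovChainZ πZ PZ μZ)
    (hπX : ∀ a : A, πX a ≠ 0) (hπY : ∀ b : B, πY b ≠ 0) (hπZ : ∀ c : C, πZ c ≠ 0)
    (hfX : μX.map (fun ω (n : ℤ) => f (ω n)) = μZ)
    (hgY : μY.map (fun ω (n : ℤ) => g (ω n)) = μZ) (m n : ℕ → ℕ) {φ φr : Delta f g → ℝ≥0∞}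
    (hφ : ∀ d, Tendsto (fun k => phim (Rmat PX PY PZ f g) (m k) d) atTop (𝓝 (φ d)))
    (hφr : ∀ d, Tendsto (fun k =>
        phim (Rmat (revMat πX PX) (revMat πY PY) (revMat πZ PZ) f g) (n k) d) atTop (𝓝 (φr d)))
    (hφfin : ∀ d, φ d ≠ ⊤) (hφrfin : ∀ d, φr d ≠ ⊤) :
    ∑' d, piW πX πY πZ f g φ φr d = 1 := by
  rw [tsum_delta, ← show ∑' a, πX a = 1 from hX.2.1]
  refine tsum_congr fun a => ?_
  refine tendsto_nhds_unique (ennreal_tendsto_tsum_of_dominated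
    (u := fun k (b : {b // f a = g b}) => piW πX πY πZ f g (phim (Rmat PX PY PZ f g) (m k))
      (phim (Rmat (revMat πX PX) (revMat πY PY) (revMat πZ PZ) f g) (n k)) ⟨(a, b.1), b.2⟩)
    (bound := fun b => πY b.1)
    (fun k b => piW_phim_le hX hY hZ hπX hπY hπZ hfX hgY (m k) (n k) ⟨(a, b.1), b.2⟩)
    ?_ fun b => ?_) ?_
  · refine ne_top_of_le_ne_top ENNReal.one_ne_top (le_trans
      (ENNReal.tsum_comp_le_tsum_of_injective Subtype.val_injective πY) (le_of_eq hY.2.1))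
  · have hq : πX a * πY b.1 / πZ (f a) ≠ ⊤ :=
      ENNReal.div_ne_top (ENNReal.mul_ne_top (hX.stationary_ne_top _) (hY.stationary_ne_top _))
        (hπZ _)
    exact ENNReal.Tendsto.mul
      (ENNReal.Tendsto.const_mul (hφ _) (Or.inr hq))
      (Or.inr (hφrfin _)) (hφr _) (Or.inr (ENNReal.mul_ne_top hq (hφfin _)))
  · simp_rw [tsum_fiber_piW_phim hX hY hZ hπX hπY hπZ hfX hgY]
    exact tendsto_const_nhds

end Coupling

/-- **The stationary coupled data.** On `Δ'' = {φ > 0, φ^rev > 0}`, the vector `π` is a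
probability distribution, the matrix `P((a,b),(a',b')) = R((a,b),(a',b')) φ(a',b')/φ(a,b)`
restricts to a row-stochastic matrix satisfying `π P = π`, and detailed balance
`π(a,b) P((a,b),(a',b')) = π(a',b') P^rev((a',b'),(a,b))` holds, where
`P^rev((a,b),(a',b')) = R^rev((a,b),(a',b')) φ^rev(a',b')/φ^rev(a,b)`. -/
theorem statement_18
    {A B C : Type*} [Countable A] [Countable B] [Countable C]
    [MeasurableSpace A] [MeasurableSingletonClass A]
    [MeasurableSpace B] [MeasurableSingletonClass B]
    [MeasurableSpace C] [MeasurableSingletonClass C]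
    (πX : A → ℝ≥0∞) (PX : A → A → ℝ≥0∞) (μX : Measure (ℤ → A))
    (πY : B → ℝ≥0∞) (PY : B → B → ℝ≥0∞) (μY : Measure (ℤ → B))
    (πZ : C → ℝ≥0∞) (PZ : C → C → ℝ≥0∞) (μZ : Measure (ℤ → C))
    (f : A → C) (g : B → C)
    (hX : IsStatMarkovChainZ πX PX μX) (hY : IsStatMarkovChainZ πY PY μY)
    (hZ : IsStatMarkovChainZ πZ PZ μZ)
    (hπX : ∀ a : A, πX a ≠ 0) (hπY : ∀ b : B, πY b ≠ 0) (hπZ : ∀ c : C, πZ c ≠ 0)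
    (hfX : μX.map (fun ω (n : ℤ) => f (ω n)) = μZ)
    (hgY : μY.map (fun ω (n : ℤ) => g (ω n)) = μZ)
    (φ φr : Delta f g → ℝ≥0∞)
    (hφ : ∀ d : Delta f g,
      Tendsto (fun m => phim (Rmat PX PY PZ f g) m d) atTop (𝓝 (φ d)))
    (hφr : ∀ d : Delta f g,
      Tendsto (fun m =>
        phim (Rmat (revMat πX PX) (revMat πY PY) (revMat πZ PZ) f g) m d) atTop (𝓝 (φr d)))
    (hφfin : ∀ d : Delta f g, φ d ≠ ⊤) (hφrfin : ∀ d : Delta f g, φr d ≠ ⊤) :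
    (∑' d : {d : Delta f g // φ d ≠ 0 ∧ φr d ≠ 0}, piW πX πY πZ f g φ φr d.1 = 1) ∧
    (∀ d : {d : Delta f g // φ d ≠ 0 ∧ φr d ≠ 0},
      ∑' e : {e : Delta f g // φ e ≠ 0 ∧ φr e ≠ 0},
        Rmat PX PY PZ f g d.1 e.1 * φ e.1 / φ d.1 = 1) ∧
    (∀ e : {e : Delta f g // φ e ≠ 0 ∧ φr e ≠ 0},
      ∑' d : {d : Delta f g // φ d ≠ 0 ∧ φr d ≠ 0},
        piW πX πY πZ f g φ φr d.1 * (Rmat PX PY PZ f g d.1 e.1 * φ e.1 / φ d.1)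
        = piW πX πY πZ f g φ φr e.1) ∧
    (∀ d e : {d : Delta f g // φ d ≠ 0 ∧ φr d ≠ 0},
      piW πX πY πZ f g φ φr d.1 * (Rmat PX PY PZ f g d.1 e.1 * φ e.1 / φ d.1)
        = piW πX πY πZ f g φ φr e.1
          * (Rmat (revMat πX PX) (revMat πY PY) (revMat πZ PZ) f g e.1 d.1
              * φr d.1 / φr e.1)) := by
  set R := Rmat PX PY PZ f g with hR
  set R' := Rmat (revMat πX PX) (revMat πY PY) (revMat πZ PZ) f g with hR'
  let q : Delta f g → ℝ≥0∞ := fun d => πX d.1.1 * πY d.1.2 / πZ (f d.1.1)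
  have hq0 : ∀ d, q d ≠ 0 := fun d =>
    ENNReal.div_ne_zero.2 ⟨mul_ne_zero (hπX _) (hπY _), hZ.stationary_ne_top _⟩
  have hqt : ∀ d, q d ≠ ⊤ := fun d =>
    ENNReal.div_ne_top (ENNReal.mul_ne_top (hX.stationary_ne_top _) (hY.stationary_ne_top _))
      (hπZ _)
  have hdual : ∀ d e, q d * R d e = q e * R' e d := Rmat_duality hX hY hZ hπX hπY hπZ hfX
  have hle := piW_phim_le hX hY hZ hπX hπY hπZ hfX hgY
  have hfin1 : ∀ d, phim R 1 d ≠ ⊤ := fun d h => by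
    refine ne_top_of_le_ne_top (hY.stationary_ne_top _) (hle 1 0 d) ?_
    rw [← hR, piW, h, phim, mul_one]
    exact ENNReal.mul_top (hq0 d)
  have hfin1' : ∀ d, phim R' 1 d ≠ ⊤ := fun d h => by
    refine ne_top_of_le_ne_top (hY.stationary_ne_top _) (hle 0 1 d) ?_
    rw [← hR', piW, h, phim, mul_one]
    exact ENNReal.mul_top (hq0 d)
  have hsum := tsum_piW_limit_eq_one hX hY hZ hπX hπY hπZ hfX hgY
  have harm : ∀ d, ∑' e, R d e * φ e = φ d := by
    refine tsum_mul_limit_phim_eq hq0 hqt hdual hφ (Rmat_ne_top hX.2.2.1 hY.2.2.1) ?_ ?_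
    · rw [← hsum (fun k => k) (fun _ => 0) hφ (fun _ => tendsto_const_nhds) hφfin
        (fun d => ENNReal.one_ne_top)]
      exact tsum_congr fun d => (mul_one _).symm
    · rw [← hsum (fun k => k) (fun _ => 1) hφ (fun _ => tendsto_const_nhds) hφfin hfin1']
      exact tsum_congr fun d => mul_right_comm _ _ _
  have harm' : ∀ d, ∑' e, R' d e * φr e = φr d := by
    refine tsum_mul_limit_phim_eq hq0 hqt (fun d e => (hdual e d).symm) hφr
      (Rmat_ne_top (isStochastic_revMat hπX hX) (isStochastic_revMat hπY hY)) ?_ ?_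
    · rw [← hsum (fun _ => 0) (fun k => k) (fun _ => tendsto_const_nhds) hφr
        (fun d => ENNReal.one_ne_top) hφrfin]
      exact tsum_congr fun d => congrArg (· * φr d) (mul_one _).symm
    · exact hsum (fun _ => 1) (fun k => k) (fun _ => tendsto_const_nhds) hφr hfin1 hφrfin
  have hbal : ∀ d e : {d : Delta f g // φ d ≠ 0 ∧ φr d ≠ 0},
      piW πX πY πZ f g φ φr d.1 * (R d.1 e.1 * φ e.1 / φ d.1)
        = piW πX πY πZ f g φ φr e.1 * (R' e.1 d.1 * φr d.1 / φr e.1) := fun d e =>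
    transform_detailed_balance hdual d.2.1 (hφfin _) e.2.2 (hφrfin _)
  refine ⟨?_, fun d => ?_, fun e => ?_, hbal⟩
  · rw [← hsum (fun k => k) (fun k => k) hφ hφr hφfin hφrfin]
    refine tsum_subtype_eq_of_support_subset (s := {d | φ d ≠ 0 ∧ φr d ≠ 0}) fun d hd => ?_
    exact ⟨right_ne_zero_of_mul (left_ne_zero_of_mul hd), right_ne_zero_of_mul hd⟩
  · exact tsum_transform_eq_one hq0 hdual harm harm' hφfin {d | φ d ≠ 0 ∧ φr d ≠ 0}
      (fun _ h h' => ⟨h, h'⟩) d.2.1 d.2.2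
  · have hrow := tsum_transform_eq_one hq0 (fun d e => (hdual e d).symm) harm' harm hφrfin
      {d | φ d ≠ 0 ∧ φr d ≠ 0} (fun _ h h' => ⟨h', h⟩) e.2.2 e.2.1
    simp_rw [hbal _ e]
    rw [ENNReal.tsum_mul_left]
    exact (congrArg (_ * ·) hrow).trans (mul_one _)
end
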